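/- arXiv:0902.1736 — 4 statements merged into one kernel-verified Lean document; each statement's English description precedes it below -/
import Mathlib

section
/- For every n ∈ ℕ and q ∈ [0,1], the total variation distance between the binomial distribution with parameters n and q and the Poisson distribution with mean n·q is at most n·q^2. -/
open MeasureTheory ProbabilityTheory Filter Set

/-- The Poisson probability mass function with mean `δ`: mass `δ^k e^{-δ}/k!` at `k`. -/
noncomputable def poissonPMF (δ : ℝ) (k : ℕ) : ℝ :=
  δ ^ k * Real.exp (-δ) / (Nat.factorial k)

/-- The binomial probability mass function with parameters `n` and `q`:
mass `C(n,k) q^k (1-q)^(n-k)` at `k` (which vanishes for `k > n`). -/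
noncomputable def binomialPMF (n : ℕ) (q : ℝ) (k : ℕ) : ℝ :=
  (n.choose k : ℝ) * q ^ k * (1 - q) ^ (n - k)

lemma bp_hasSum (δ : ℝ) : HasSum (_root_.poissonPMF δ) 1 := by
  have h := (NormedSpace.expSeries_div_hasSum_exp δ).mul_right (Real.exp (-δ))
  rw [← Real.exp_eq_exp_ℝ, ← Real.exp_add, add_neg_cancel, Real.exp_zero] at h
  refine h.congr_fun ?_ |> fun h => h
  intro k
  simp only [_root_.poissonPMF]
  ring

lemma bp_nonneg {δ : ℝ} (h : 0 ≤ δ) (k : ℕ) : 0 ≤ _root_.poissonPMF δ k := by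
  unfold _root_.poissonPMF; positivity

lemma bp_summable {δ : ℝ} (h : 0 ≤ δ) {f : ℕ → ℝ} (hf : ∀ k, f k ∈ Set.Icc (0 : ℝ) 1) :
    Summable fun k => _root_.poissonPMF δ k * f k :=
  Summable.of_nonneg_of_le (fun k => mul_nonneg (bp_nonneg h k) (hf k).1)
    (fun k => mul_le_of_le_one_right (bp_nonneg h k) (hf k).2) (bp_hasSum δ).summable

lemma bp_conv_pmf (a b : ℝ) (n : ℕ) :
    _root_.poissonPMF (a + b) n
      = ∑ p ∈ Finset.HasAntidiagonal.antidiagonal n, _root_.poissonPMF a p.1 * _root_.poissonPMF b p.2 := by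
  unfold _root_.poissonPMF
  rw [(Commute.all a b).add_pow', Finset.sum_mul, Finset.sum_div]
  refine Finset.sum_congr rfl fun p hp => ?_
  rw [Finset.HasAntidiagonal.mem_antidiagonal] at hp
  have h := Nat.add_choose_mul_factorial_mul_factorial p.1 p.2
  rw [← Nat.choose_symm_add, hp] at h
  have h' : ((n.choose p.1 : ℝ)) * p.1.factorial * p.2.factorial = n.factorial := by
    exact_mod_cast h
  rw [neg_add, Real.exp_add, nsmul_eq_mul, ← h']
  have h1 : (p.1.factorial : ℝ) ≠ 0 := by positivity
  have h2 : (p.2.factorial : ℝ) ≠ 0 := by positivity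
  have h3 : (n.choose p.1 : ℝ) ≠ 0 := by
    have := Nat.choose_pos (n := n) (k := p.1) (by omega)
    positivity
  field_simp

lemma bp_conv {a b : ℝ} (ha : 0 ≤ a) (hb : 0 ≤ b) {f : ℕ → ℝ}
    (hf : ∀ k, f k ∈ Set.Icc (0 : ℝ) 1) :
    ∑' n, _root_.poissonPMF (a + b) n * f n
      = ∑' i, _root_.poissonPMF a i * ∑' j, _root_.poissonPMF b j * f (i + j) := by
  have hs : Summable fun x : ℕ × ℕ => _root_.poissonPMF a x.1 * _root_.poissonPMF b x.2 :=
    (bp_hasSum a).summable.mul_of_nonneg (bp_hasSum b).summable (bp_nonneg ha) (bp_nonneg hb)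
  have hF : Summable fun x : ℕ × ℕ => _root_.poissonPMF a x.1 * _root_.poissonPMF b x.2 * f (x.1 + x.2) :=
    Summable.of_nonneg_of_le
      (fun x => mul_nonneg (mul_nonneg (bp_nonneg ha _) (bp_nonneg hb _)) (hf _).1)
      (fun x => mul_le_of_le_one_right (mul_nonneg (bp_nonneg ha _) (bp_nonneg hb _)) (hf _).2) hs
  have h1 : ∑' x : ℕ × ℕ, _root_.poissonPMF a x.1 * _root_.poissonPMF b x.2 * f (x.1 + x.2)
      = ∑' i, _root_.poissonPMF a i * ∑' j, _root_.poissonPMF b j * f (i + j) := by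
    rw [hF.tsum_prod]
    refine tsum_congr fun i => ?_
    rw [← tsum_mul_left]
    exact tsum_congr fun j => by ring
  rw [← h1, ← Finset.HasAntidiagonal.sigmaAntidiagonalEquivProd.tsum_eq]
  have hG := Finset.HasAntidiagonal.sigmaAntidiagonalEquivProd.summable_iff.mpr hF
  refine Eq.trans ?_ hG.tsum_sigma.symm
  refine tsum_congr fun n => ?_
  rw [bp_conv_pmf, Finset.sum_mul, tsum_fintype, ← Finset.sum_coe_sort]
  refine Finset.sum_congr rfl fun p _ => ?_
  have := Finset.HasAntidiagonal.mem_antidiagonal.mp p.2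
  simp [Finset.HasAntidiagonal.sigmaAntidiagonalEquivProd, this]

lemma bp_step {q : ℝ} (h0 : 0 ≤ q) {f : ℕ → ℝ} (hf : ∀ k, f k ∈ Set.Icc (0 : ℝ) 1) :
    |((1 - q) * f 0 + q * f 1) - ∑' j, _root_.poissonPMF q j * f j| ≤ q ^ 2 := by
  have e1 := (bp_summable h0 hf).sum_add_tsum_nat_add 2
  have e2 := (bp_hasSum q).summable.sum_add_tsum_nat_add 2
  rw [(bp_hasSum q).tsum_eq] at e2
  have hle : ∑' i, _root_.poissonPMF q (i + 2) * f (i + 2) ≤ ∑' i, _root_.poissonPMF q (i + 2) :=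
    Summable.tsum_le_tsum (fun i => mul_le_of_le_one_right (bp_nonneg h0 _) (hf _).2)
      ((summable_nat_add_iff 2).mpr (bp_summable h0 hf))
      ((summable_nat_add_iff 2).mpr (bp_hasSum q).summable)
  have hge : 0 ≤ ∑' i, _root_.poissonPMF q (i + 2) * f (i + 2) :=
    tsum_nonneg fun i => mul_nonneg (bp_nonneg h0 _) (hf _).1
  rw [← e1]
  have p0 : _root_.poissonPMF q 0 = Real.exp (-q) := by simp [_root_.poissonPMF]
  have p1 : _root_.poissonPMF q 1 = q * Real.exp (-q) := by simp [_root_.poissonPMF]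
  simp only [Finset.sum_range_succ, Finset.sum_range_zero, p0, p1, zero_add] at e2 ⊢
  have x1 := Real.add_one_le_exp (-q)
  have x2 : Real.exp (-q) ≤ 1 := Real.exp_le_one_iff.mpr (by linarith)
  set E := Real.exp (-q)
  have y0 : 0 ≤ (E - 1 + q) * f 0 := mul_nonneg (by linarith) (hf 0).1
  have y0' : (E - 1 + q) * f 0 ≤ E - 1 + q := mul_le_of_le_one_right (by linarith) (hf 0).2
  have y1 : 0 ≤ (q * (1 - E)) * f 1 := mul_nonneg (mul_nonneg h0 (by linarith)) (hf 1).1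
  have y1' : (q * (1 - E)) * f 1 ≤ q * (1 - E) :=
    mul_le_of_le_one_right (mul_nonneg h0 (by linarith)) (hf 1).2
  have z : q * (1 - E) ≤ q ^ 2 := by nlinarith
  rw [abs_le]
  constructor <;> nlinarith

lemma bp_binom_succ (n : ℕ) (q : ℝ) (f : ℕ → ℝ) :
    ∑ k ∈ Finset.range (n + 2), binomialPMF (n + 1) q k * f k
      = ∑ k ∈ Finset.range (n + 1), binomialPMF n q k * ((1 - q) * f k + q * f (k + 1)) := by
  have hz : binomialPMF n q (n + 1) = 0 := by simp [binomialPMF]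
  have h : ∑ k ∈ Finset.range (n + 1), binomialPMF n q k * f k
      = ∑ k ∈ Finset.range (n + 1), binomialPMF n q (k + 1) * f (k + 1)
        + binomialPMF n q 0 * f 0 := by
    rw [← Finset.sum_range_succ' (fun k => binomialPMF n q k * f k), Finset.sum_range_succ _ (n + 1), hz]
    ring
  have hr : ∑ k ∈ Finset.range (n + 1), binomialPMF n q k * ((1 - q) * f k + q * f (k + 1))
      = (1 - q) * ∑ k ∈ Finset.range (n + 1), binomialPMF n q k * f k
        + ∑ k ∈ Finset.range (n + 1), q * binomialPMF n q k * f (k + 1) := by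
    rw [Finset.mul_sum, ← Finset.sum_add_distrib]
    exact Finset.sum_congr rfl fun k _ => by ring
  rw [hr, h, Finset.sum_range_succ', mul_add, Finset.mul_sum, add_right_comm,
    ← Finset.sum_add_distrib]
  congr 1
  · refine Finset.sum_congr rfl fun k hk => ?_
    rw [Finset.mem_range] at hk
    unfold binomialPMF
    rw [Nat.choose_succ_succ]
    rcases Nat.lt_or_ge k n with hkn | hkn
    · obtain ⟨d, rfl⟩ := Nat.exists_eq_add_of_lt hkn
      have e1 : k + d + 1 + 1 - (k + 1) = d + 1 := by omega
      have e2 : k + d + 1 - (k + 1) = d := by omega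
      have e3 : k + d + 1 - k = d + 1 := by omega
      rw [e1, e2, e3]
      push_cast
      ring
    · have : k = n := by omega
      subst this
      simp only [Nat.choose_self, Nat.choose_succ_self, Nat.sub_self, Nat.cast_zero, Nat.cast_one,
        add_zero, pow_zero]
      ring
  · simp [binomialPMF]
    ring

lemma bp_main {q : ℝ} (h0 : 0 ≤ q) (h1 : q ≤ 1) (n : ℕ) : ∀ f : ℕ → ℝ,
    (∀ k, f k ∈ Set.Icc (0 : ℝ) 1) →
    |∑ k ∈ Finset.range (n + 1), binomialPMF n q k * f k - ∑' k, _root_.poissonPMF (n * q) k * f k|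
      ≤ n * q ^ 2 := by
  induction n with
  | zero =>
    intro f hf
    rw [tsum_eq_single 0]
    · simp [binomialPMF, _root_.poissonPMF]
    · intro k hk
      simp [_root_.poissonPMF, hk]
  | succ n ih =>
    intro f hf
    have hS : ∀ k, (1 - q) * f k + q * f (k + 1) ∈ Set.Icc (0 : ℝ) 1 := by
      intro k
      have a := hf k
      have b := hf (k + 1)
      constructor
      · have := mul_nonneg (sub_nonneg.mpr h1) a.1
        have := mul_nonneg h0 b.1
        linarith
      · have := mul_le_mul_of_nonneg_left a.2 (sub_nonneg.mpr h1)
        have := mul_le_mul_of_nonneg_left b.2 h0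
        linarith
    have hT : ∀ i, ∑' j, _root_.poissonPMF q j * f (i + j) ∈ Set.Icc (0 : ℝ) 1 := by
      intro i
      refine ⟨tsum_nonneg fun j => mul_nonneg (bp_nonneg h0 _) (hf _).1, ?_⟩
      rw [← (bp_hasSum q).tsum_eq]
      exact Summable.tsum_le_tsum (fun j => mul_le_of_le_one_right (bp_nonneg h0 _) (hf _).2)
        (bp_summable h0 (f := fun j => f (i + j)) fun j => hf _) (bp_hasSum q).summable
    have hn : 0 ≤ (n : ℝ) * q := by positivity
    have hI := ih _ hS
    rw [bp_binom_succ]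
    have hc : ((n + 1 : ℕ) : ℝ) * q = n * q + q := by push_cast; ring
    rw [hc, bp_conv hn h0 hf]
    have hd : |∑' k, _root_.poissonPMF (n * q) k * ((1 - q) * f k + q * f (k + 1))
        - ∑' i, _root_.poissonPMF (n * q) i * ∑' j, _root_.poissonPMF q j * f (i + j)| ≤ q ^ 2 := by
      rw [← (bp_summable hn hS).tsum_sub (bp_summable hn hT), ← Real.norm_eq_abs]
      have hb := (bp_hasSum (n * q)).mul_right (q ^ 2)
      rw [one_mul] at hb
      refine tsum_of_norm_bounded hb fun i => ?_
      rw [← mul_sub, norm_mul, Real.norm_of_nonneg (bp_nonneg hn i), Real.norm_eq_abs]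
      exact mul_le_mul_of_nonneg_left
        (bp_step h0 (f := fun j => f (i + j)) fun j => hf _) (bp_nonneg hn i)
    push_cast
    calc _ ≤ _ := abs_sub_le _ (∑' k, _root_.poissonPMF (n * q) k * ((1 - q) * f k + q * f (k + 1))) _
      _ ≤ n * q ^ 2 + q ^ 2 := add_le_add hI hd
      _ = _ := by ring

/-- For every `n ∈ ℕ` and `q ∈ [0,1]`, the total variation distance between the binomial
distribution with parameters `n` and `q` and the Poisson distribution with mean `n·q` is at
most `n·q²`: for every subset `A` of `ℕ`, the difference of the probabilities of `A` is at
most `n·q²` in absolute value. -/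
theorem binomial_poisson_total_variation (n : ℕ) (q : ℝ) (hq : q ∈ Set.Icc (0 : ℝ) 1) :
    ∀ A : Set ℕ,
      |(∑' k : ℕ, A.indicator (binomialPMF n q) k)
          - ∑' k : ℕ, A.indicator (poissonPMF (n * q)) k|
        ≤ n * q ^ 2 := by
  intro A
  have hi : ∀ (g : ℕ → ℝ) k, A.indicator g k = g k * A.indicator (fun _ => (1 : ℝ)) k := by
    intro g k
    by_cases h : k ∈ A <;> simp [h]
  have h := bp_main hq.1 hq.2 n (A.indicator fun _ => (1 : ℝ)) (by
    intro k
    by_cases h : k ∈ A <;> simp [h])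
  simp only [hi (binomialPMF n q), hi (_root_.poissonPMF (n * q))]
  rw [tsum_eq_sum (s := Finset.range (n + 1))]
  · exact h
  · intro k hk
    rw [Finset.mem_range, not_lt] at hk
    have : n.choose k = 0 := Nat.choose_eq_zero_of_lt (by omega)
    simp [binomialPMF, this]
end

section
/- Let a > 0, B > 0, and let S have the Pareto distribution of shape a and location B. For p > 0 and integer j ≥ 0 set ℚ_j(p) = E((pS)^j e^{−pS})/j!. Then for every integer j with j > a, lim_{p → 0+} ℚ_j(p)/(pB)^a = a Γ(j − a)/j!, where Γ is the Gamma function Γ(x) = ∫_0^∞ u^{x−1} e^{−u} du. -/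
open MeasureTheory ProbabilityTheory Filter Set Topology

/-- Let `S` have the Pareto distribution of shape `a > 0` and location `B > 0`, and for
`p > 0` and `j ∈ ℕ` set `ℚ_j(p) = E((pS)^j e^{−pS})/j!`. Then for every integer `j > a`,
`lim_{p → 0+} ℚ_j(p)/(pB)^a = a Γ(j − a)/j!`. -/
theorem pareto_mixed_poisson_asymptotics
    {Ω : Type*} [MeasureSpace Ω] [IsProbabilityMeasure (ℙ : Measure Ω)]
    (a B : ℝ) (ha : 0 < a) (hB : 0 < B)
    (S : Ω → ℝ) (hS : Measurable S)
    (hlaw : Measure.map S ℙ = ProbabilityTheory.paretoMeasure B a)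
    (j : ℕ) (hj : a < j) :
    Tendsto
      (fun p : ℝ =>
        ((∫ ω, (p * S ω) ^ j * Real.exp (-(p * S ω))) / (Nat.factorial j : ℝ))
          / (p * B) ^ a)
      (𝓝[>] 0)
      (𝓝 (a * Real.Gamma ((j : ℝ) - a) / (Nat.factorial j : ℝ))) := by
  set f : ℝ → ℝ := fun u => Real.exp (-u) * u ^ ((j : ℝ) - a - 1) with hf
  have hja : 0 < (j : ℝ) - a := by linarith
  have hint : IntegrableOn f (Ioi 0) := Real.GammaIntegral_convergent hja
  have hlim0 : Tendsto (fun p : ℝ => p * B) (𝓝[>] 0) (𝓝 0) := by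
    have : Tendsto (fun p : ℝ => p * B) (𝓝 0) (𝓝 (0 * B)) :=
      (continuous_id.mul continuous_const).tendsto 0
    rw [zero_mul] at this
    exact this.mono_left nhdsWithin_le_nhds
  have hlim : Tendsto (fun p : ℝ => ∫ u in Ioi (p * B), f u) (𝓝[>] 0)
      (𝓝 (Real.Gamma ((j : ℝ) - a))) := by
    have h1 := (aecover_Ioi_of_Ioi (μ := volume) hlim0).integral_tendsto_of_countably_generated hint
    rw [Real.Gamma_eq_integral hja]
    refine h1.congr' ?_
    filter_upwards [self_mem_nhdsWithin] with p hp
    have hp : 0 < p := hp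
    rw [Measure.restrict_restrict measurableSet_Ioi, inter_eq_left.2]
    exact Ioi_subset_Ioi (by positivity)
  have hmain : ∀ p : ℝ, 0 < p → (∫ ω, (p * S ω) ^ j * Real.exp (-(p * S ω)))
      = a * (p * B) ^ a * ∫ u in Ioi (p * B), f u := by
    intro p hp
    have e1 : (∫ ω, (p * S ω) ^ j * Real.exp (-(p * S ω)))
        = ∫ x, (p * x) ^ j * Real.exp (-(p * x)) ∂(paretoMeasure B a) := by
      rw [← hlaw, integral_map hS.aemeasurable]
      exact (by fun_prop : Continuous fun x : ℝ =>
        (p * x) ^ j * Real.exp (-(p * x))).aestronglyMeasurable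
    have e2 : (∫ x, (p * x) ^ j * Real.exp (-(p * x)) ∂(paretoMeasure B a))
        = ∫ x, paretoPDFReal B a x * ((p * x) ^ j * Real.exp (-(p * x))) := by
      rw [paretoMeasure, integral_withDensity_eq_integral_toReal_smul (f := paretoPDF B a)
        (measurable_paretoPDFReal B a).ennreal_ofReal (by simp [paretoPDF])]
      refine integral_congr_ae (Eventually.of_forall fun x => ?_)
      simp [paretoPDF, ENNReal.toReal_ofReal (paretoPDFReal_nonneg hB.le ha.le x)]
    have e3 : (∫ x, paretoPDFReal B a x * ((p * x) ^ j * Real.exp (-(p * x))))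
        = ∫ x in Ioi B, a * B ^ a * p ^ (a + 1) * f (p * x) := by
      rw [← integral_Ici_eq_integral_Ioi, ← integral_indicator measurableSet_Ici]
      refine integral_congr_ae (Eventually.of_forall fun x => ?_)
      by_cases hx : B ≤ x
      · have hx0 : 0 < x := hB.trans_le hx
        have hpx : 0 < p * x := by positivity
        have h2 : (p * x) ^ ((j : ℝ) - a - 1) = (p * x) ^ j * (p ^ (a+1) )⁻¹ * x ^ (-(a+1)) := by
          rw [show (j : ℝ) - a - 1 = j + -(a+1) by ring, Real.rpow_add hpx, Real.rpow_natCast,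
            Real.mul_rpow hp.le hx0.le, Real.rpow_neg hp.le (a+1), mul_assoc]
        have h3 : p ^ (a+1) ≠ 0 := (Real.rpow_pos_of_pos hp _).ne'
        simp only [paretoPDFReal, hx, if_true, indicator, mem_Ici, hf, h2]
        field_simp
      · simp [paretoPDFReal, hx, indicator]
    rw [e1, e2, e3, integral_const_mul, integral_comp_mul_left_Ioi f B hp,
      Real.mul_rpow hp.le hB.le, Real.rpow_add hp, Real.rpow_one, smul_eq_mul]
    field_simp
  have hfin := (hlim.const_mul a).div_const (Nat.factorial j : ℝ)
  refine hfin.congr' ?_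
  filter_upwards [self_mem_nhdsWithin] with p hp
  have hp : 0 < p := hp
  have : (p * B) ^ a ≠ 0 := (Real.rpow_pos_of_pos (by positivity) _).ne'
  rw [hmain p hp]
  field_simp
end

section
/- Let a > 0, B > 0, and let S have the Pareto distribution of shape a and location B. For p > 0 and integer j ≥ 0 set ℚ_j(p) = E((pS)^j e^{−pS})/j!. Then for every integer j with j > a, lim_{p → 0+} ℚ_{j+1}(p)/ℚ_j(p) = (j − a)/(j + 1) = 1 − (a + 1)/(j + 1). -/
open MeasureTheory ProbabilityTheory Filter Set Topology

lemma pareto_mp_moment {Ω : Type*} [MeasureSpace Ω]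
    (a B : ℝ) (ha : 0 < a) (hB : 0 < B)
    (S : Ω → ℝ) (hS : Measurable S)
    (hlaw : Measure.map S ℙ = ProbabilityTheory.paretoMeasure B a)
    (k : ℕ) (p : ℝ) (hp : 0 < p) :
    ∫ ω, (p * S ω) ^ k * Real.exp (-(p * S ω)) =
      (a * B ^ a * p ^ a) *
        ∫ u in Ioi (p * B), Real.exp (-u) * u ^ ((k : ℝ) - a - 1) := by
  have h1 : ∫ ω, (p * S ω) ^ k * Real.exp (-(p * S ω)) =
      ∫ x, (p * x) ^ k * Real.exp (-(p * x)) ∂(Measure.map S ℙ) := by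
    rw [integral_map hS.aemeasurable]
    exact (by fun_prop : Continuous fun x : ℝ => (p * x) ^ k * Real.exp (-(p * x))).aestronglyMeasurable
  have hm : Measurable (paretoPDF B a) := (measurable_paretoPDFReal B a).ennreal_ofReal
  rw [h1, hlaw, paretoMeasure, integral_withDensity_eq_integral_toReal_smul hm
    (ae_of_all _ fun x => ENNReal.ofReal_lt_top)]
  have h2 : ∀ x : ℝ, (paretoPDF B a x).toReal • ((p * x) ^ k * Real.exp (-(p * x))) =
      (Ici B).indicator (fun x => (a * B ^ a * p ^ (a + 1)) *
        (Real.exp (-(p * x)) * (p * x) ^ ((k : ℝ) - a - 1))) x := by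
    intro x
    rw [paretoPDF, ENNReal.toReal_ofReal (paretoPDFReal_nonneg hB.le ha.le x), paretoPDFReal,
      indicator_apply]
    by_cases hx : B ≤ x
    · have hx0 : 0 < x := hB.trans_le hx
      have hpx : 0 < p * x := mul_pos hp hx0
      rw [if_pos hx, if_pos (mem_Ici.2 hx), sub_sub, Real.rpow_sub hpx, Real.rpow_natCast,
        Real.rpow_neg hx0.le, Real.mul_rpow hp.le hx0.le, smul_eq_mul]
      have := Real.rpow_pos_of_pos hp (a + 1)
      have := Real.rpow_pos_of_pos hx0 (a + 1)
      field_simp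
    · rw [if_neg hx, if_neg (by simpa using hx), zero_smul]
  simp_rw [h2]
  rw [integral_indicator measurableSet_Ici, integral_Ici_eq_integral_Ioi, integral_const_mul,
    integral_comp_mul_left_Ioi (fun u => Real.exp (-u) * u ^ ((k : ℝ) - a - 1)) B hp,
    Real.rpow_add hp, Real.rpow_one, smul_eq_mul]
  field_simp

lemma pareto_mp_tendsto (a B : ℝ) (hB : 0 < B) (k : ℕ) (hk : a < k) :
    Tendsto (fun p : ℝ => ∫ u in Ioi (p * B), Real.exp (-u) * u ^ ((k : ℝ) - a - 1))
      (𝓝[>] 0) (𝓝 (Real.Gamma ((k : ℝ) - a))) := by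
  rw [Real.Gamma_eq_integral (sub_pos.2 hk)]
  have hi := Real.GammaIntegral_convergent (sub_pos.2 hk)
  have ht : Tendsto (fun p : ℝ => p * B) (𝓝[>] 0) (𝓝 0) := by
    have : Continuous fun p : ℝ => p * B := by fun_prop
    simpa using (this.tendsto 0).mono_left nhdsWithin_le_nhds
  have h := (aecover_Ioi_of_Ioi (μ := volume) ht).integral_tendsto_of_countably_generated hi
  refine h.congr' ?_
  filter_upwards [self_mem_nhdsWithin] with p hp
  have hp : 0 < p := hp
  rw [Measure.restrict_restrict measurableSet_Ioi,
    inter_eq_left.2 (Ioi_subset_Ioi (by positivity))]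

/-- Let `S` have the Pareto distribution of shape `a > 0` and location `B > 0`, and for
`p > 0` and `j ∈ ℕ` set `ℚ_j(p) = E((pS)^j e^{−pS})/j!`. Then for every integer `j > a`,
`lim_{p → 0+} ℚ_{j+1}(p)/ℚ_j(p) = (j − a)/(j + 1) = 1 − (a + 1)/(j + 1)`. -/
theorem pareto_mixed_poisson_ratio_limit
    {Ω : Type*} [MeasureSpace Ω] [IsProbabilityMeasure (ℙ : Measure Ω)]
    (a B : ℝ) (ha : 0 < a) (hB : 0 < B)
    (S : Ω → ℝ) (hS : Measurable S)
    (hlaw : Measure.map S ℙ = ProbabilityTheory.paretoMeasure B a)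
    (j : ℕ) (hj : a < j) :
    Tendsto
      (fun p : ℝ =>
        ((∫ ω, (p * S ω) ^ (j + 1) * Real.exp (-(p * S ω))) / (Nat.factorial (j + 1) : ℝ))
          / ((∫ ω, (p * S ω) ^ j * Real.exp (-(p * S ω))) / (Nat.factorial j : ℝ)))
      (𝓝[>] 0)
      (𝓝 (((j : ℝ) - a) / ((j : ℝ) + 1)))
    ∧ ((j : ℝ) - a) / ((j : ℝ) + 1) = 1 - (a + 1) / ((j : ℝ) + 1) := by
  have hj' : a < ((j + 1 : ℕ) : ℝ) := by push_cast; linarith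
  have hG : 0 < Real.Gamma ((j : ℝ) - a) := Real.Gamma_pos_of_pos (sub_pos.2 hj)
  refine ⟨?_, by field_simp; ring⟩
  have h := ((pareto_mp_tendsto a B hB (j + 1) hj').div_const ((Nat.factorial (j + 1) : ℝ))).div
    ((pareto_mp_tendsto a B hB j hj).div_const ((Nat.factorial j : ℝ))) (by positivity)
  have e : Real.Gamma (((j + 1 : ℕ) : ℝ) - a) / (Nat.factorial (j + 1) : ℝ) /
      (Real.Gamma ((j : ℝ) - a) / (Nat.factorial j : ℝ)) = ((j : ℝ) - a) / ((j : ℝ) + 1) := by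
    have : ((j + 1 : ℕ) : ℝ) - a = ((j : ℝ) - a) + 1 := by push_cast; ring
    rw [this, Real.Gamma_add_one (sub_pos.2 hj).ne', Nat.factorial_succ]
    push_cast
    have := Nat.factorial_pos j
    field_simp
  rw [e] at h
  refine h.congr' ?_
  filter_upwards [self_mem_nhdsWithin] with p hp
  have hp : 0 < p := hp
  have hc : a * B ^ a * p ^ a ≠ 0 := by positivity
  rw [pareto_mp_moment a B ha hB S hS hlaw (j + 1) p hp,
    pareto_mp_moment a B ha hB S hS hlaw j p hp, Pi.div_apply, mul_div_assoc _ _ (((j + 1).factorial : ℕ) : ℝ),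
    mul_div_assoc _ _ ((j.factorial : ℕ) : ℝ),
    mul_div_mul_left _ _ hc]
end

section
/- Let a > 0, B > 0, and let S have the Pareto distribution of shape a and location B. For p > 0 and integer j ≥ 0 set ℚ_j(p) = E((pS)^j e^{−pS})/j!, and define the estimator a(j, p) = (j + 1)(1 − ℚ_{j+1}(p)/ℚ_j(p)) − 1. Then for every integer j with j > a, lim_{p → 0+} a(j, p) = a. -/
open MeasureTheory ProbabilityTheory Filter Set Topology

lemma pareto_aux_moment {Ω : Type*} [MeasureSpace Ω]
    (a B : ℝ) (ha : 0 < a) (hB : 0 < B)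
    (S : Ω → ℝ) (hS : Measurable S)
    (hlaw : Measure.map S ℙ = ProbabilityTheory.paretoMeasure B a)
    (k : ℕ) (p : ℝ) (hp : 0 < p) :
    (∫ ω, (p * S ω) ^ k * Real.exp (-(p * S ω)))
      = (a * B ^ a * p ^ a) * ∫ u in Ioi (p * B), Real.exp (-u) * u ^ ((k : ℝ) - a - 1) := by
  have h1 : (∫ ω, (p * S ω) ^ k * Real.exp (-(p * S ω)))
      = ∫ x, (p * x) ^ k * Real.exp (-(p * x)) ∂(Measure.map S ℙ) := by
    rw [integral_map hS.aemeasurable]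
    exact (Continuous.aestronglyMeasurable (by fun_prop))
  have h2 : (∫ x, (p * x) ^ k * Real.exp (-(p * x)) ∂(Measure.map S ℙ))
      = ∫ x, paretoPDFReal B a x * ((p * x) ^ k * Real.exp (-(p * x))) := by
    rw [hlaw, paretoMeasure, integral_withDensity_eq_integral_toReal_smul
      (by unfold paretoPDF; fun_prop) (ae_of_all _ fun x => by simp [paretoPDF])]
    refine integral_congr_ae (ae_of_all _ fun x => ?_)
    simp [paretoPDF, ENNReal.toReal_ofReal (paretoPDFReal_nonneg hB.le ha.le x)]
  have h3 : (∫ x, paretoPDFReal B a x * ((p * x) ^ k * Real.exp (-(p * x))))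
      = ∫ x in Ioi B, (a * B ^ a * p ^ (a + 1)) *
          (Real.exp (-(p * x)) * (p * x) ^ ((k : ℝ) - a - 1)) := by
    rw [← integral_Ici_eq_integral_Ioi, ← integral_indicator measurableSet_Ici]
    refine integral_congr_ae (ae_of_all _ fun x => ?_)
    by_cases hx : B ≤ x
    · have hx0 : 0 < x := hB.trans_le hx
      have e1 : (p * x) ^ ((k : ℝ) - a - 1)
          = (p * x) ^ k * (p ^ (-(a + 1)) * x ^ (-(a + 1))) := by
        rw [← Real.mul_rpow hp.le hx0.le, ← Real.rpow_natCast, ← Real.rpow_add (by positivity)]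
        congr 1; ring
      have e2 : p ^ (a + 1) * p ^ (-(a + 1)) = 1 := by
        rw [← Real.rpow_add hp]; simp
      simp only [paretoPDFReal, if_pos hx, indicator, mem_Ici, e1]
      linear_combination (-(a * B ^ a * Real.exp (-(p * x)) * (p * x) ^ k * x ^ (-(a + 1)))) * e2
    · simp [paretoPDFReal, hx]
  rw [h1, h2, h3, integral_const_mul,
    integral_comp_mul_left_Ioi (fun u => Real.exp (-u) * u ^ ((k : ℝ) - a - 1)) B hp,
    smul_eq_mul, Real.rpow_add hp, Real.rpow_one]
  field_simp

lemma pareto_aux_tendsto (B s : ℝ) (hB : 0 < B) (hs : 0 < s) :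
    Tendsto (fun p : ℝ => ∫ u in Ioi (p * B), Real.exp (-u) * u ^ (s - 1)) (𝓝[>] 0)
      (𝓝 (Real.Gamma s)) := by
  rw [Real.Gamma_eq_integral hs]
  have hint := Real.GammaIntegral_convergent hs
  have key : Tendsto (fun p : ℝ => ∫ u in Ioi (0 : ℝ),
      (Ioi (p * B)).indicator (fun u => Real.exp (-u) * u ^ (s - 1)) u) (𝓝[>] 0)
      (𝓝 (∫ u in Ioi (0 : ℝ), Real.exp (-u) * u ^ (s - 1))) := by
    refine tendsto_integral_filter_of_dominated_convergence
      (fun u => ‖Real.exp (-u) * u ^ (s - 1)‖) ?_ ?_ hint.norm ?_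
    · exact Eventually.of_forall fun p => hint.aestronglyMeasurable.indicator measurableSet_Ioi
    · exact Eventually.of_forall fun p => ae_of_all _ fun u => norm_indicator_le_norm_self _ _
    · refine (ae_restrict_iff' measurableSet_Ioi).mpr (ae_of_all _ fun u hu => ?_)
      have hu' : (0 : ℝ) < u := hu
      refine tendsto_const_nhds.congr' ?_
      have : ∀ᶠ p in 𝓝[>] (0 : ℝ), p * B < u := by
        have hc : Tendsto (fun p : ℝ => p * B) (𝓝[>] 0) (𝓝 (0 * B)) :=
          ((continuous_id.mul continuous_const).tendsto (0 : ℝ)).mono_left nhdsWithin_le_nhds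
        rw [zero_mul] at hc
        exact hc.eventually (gt_mem_nhds hu')
      filter_upwards [this] with p hp
      rw [indicator_of_mem (show u ∈ Ioi (p * B) from hp)]
  refine key.congr' ?_
  filter_upwards [self_mem_nhdsWithin] with p hp
  have hp' : (0 : ℝ) < p := hp
  rw [setIntegral_indicator measurableSet_Ioi, inter_eq_self_of_subset_right]
  exact Ioi_subset_Ioi (by positivity)

/-- Let `S` have the Pareto distribution of shape `a > 0` and location `B > 0`, for `p > 0`
and `j ∈ ℕ` set `ℚ_j(p) = E((pS)^j e^{−pS})/j!`, and define the estimator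
`a(j, p) = (j + 1)(1 − ℚ_{j+1}(p)/ℚ_j(p)) − 1`. Then for every integer `j > a`,
`lim_{p → 0+} a(j, p) = a`. -/
theorem pareto_shape_estimator_limit
    {Ω : Type*} [MeasureSpace Ω] [IsProbabilityMeasure (ℙ : Measure Ω)]
    (a B : ℝ) (ha : 0 < a) (hB : 0 < B)
    (S : Ω → ℝ) (hS : Measurable S)
    (hlaw : Measure.map S ℙ = ProbabilityTheory.paretoMeasure B a)
    (j : ℕ) (hj : a < j) :
    Tendsto
      (fun p : ℝ =>
        ((j : ℝ) + 1)
            * (1 -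
              ((∫ ω, (p * S ω) ^ (j + 1) * Real.exp (-(p * S ω)))
                    / (Nat.factorial (j + 1) : ℝ))
                / ((∫ ω, (p * S ω) ^ j * Real.exp (-(p * S ω)))
                    / (Nat.factorial j : ℝ)))
          - 1)
      (𝓝[>] 0) (𝓝 a) := by
  have hs : 0 < (j : ℝ) - a := sub_pos.mpr hj
  have t0 := pareto_aux_tendsto B ((j : ℝ) - a) hB hs
  have t1 := pareto_aux_tendsto B ((j : ℝ) - a + 1) hB (by linarith)
  rw [Real.Gamma_add_one hs.ne'] at t1
  have hG := Real.Gamma_pos_of_pos hs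
  have t := (((((t1.div t0 hG.ne').div_const ((j : ℝ) + 1)).const_sub 1).const_mul
    ((j : ℝ) + 1)).sub_const 1)
  have hj1 : (j : ℝ) + 1 ≠ 0 := by positivity
  have hlim : ((j : ℝ) + 1) * (1 - ((j : ℝ) - a) * Real.Gamma ((j : ℝ) - a)
      / Real.Gamma ((j : ℝ) - a) / ((j : ℝ) + 1)) - 1 = a := by
    rw [mul_div_cancel_right₀ _ hG.ne']
    field_simp
    ring
  rw [hlim] at t
  refine t.congr' ?_
  filter_upwards [self_mem_nhdsWithin] with p hp
  have hp' : (0 : ℝ) < p := hp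
  rw [pareto_aux_moment a B ha hB S hS hlaw j p hp',
    pareto_aux_moment a B ha hB S hS hlaw (j + 1) p hp']
  have hC : a * B ^ a * p ^ a ≠ 0 := by positivity
  have he : ((j + 1 : ℕ) : ℝ) - a - 1 = (j : ℝ) - a + 1 - 1 := by push_cast; ring
  rw [he, Nat.factorial_succ]
  have hf : ((Nat.factorial j : ℕ) : ℝ) ≠ 0 := by positivity
  push_cast
  simp only [Pi.div_apply]
  congr 3
  generalize (∫ u in Ioi (p * B), Real.exp (-u) * u ^ ((j : ℝ) - a + 1 - 1)) = X
  generalize (∫ u in Ioi (p * B), Real.exp (-u) * u ^ ((j : ℝ) - a - 1)) = Y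
  generalize a * B ^ a * p ^ a = C at *
  field_simp
end
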